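/- Let X be Borel distributed with parameter μ ∈ (0,1) and let κ_X^{(n)} denote its n-th cumulant, i.e., the n-th derivative at 0 of log E[e^{τX}]. Then κ_X^{(1)} = 1/(1−μ), and for every n ≥ 2 the cumulants satisfy the recursion κ_X^{(n)} = (μ/(1−μ)) · Σ_{k=2}^{n} (n!/k!) Σ_{(l₁,…,l_k)} κ_X^{(l₁)} ⋯ κ_X^{(l_k)} / (l₁! ⋯ l_k!), where the inner sum is over all k-tuples of positive integers (l₁,…,l_k) with l₁ + ⋯ + l_k = n. -/

import Mathlib

section
open Finset

/-- The Taylor coefficients at `0` of a real function, as a formal power series. -/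
noncomputable def taylorPowerSeries (f : ℝ → ℝ) : PowerSeries ℝ :=
  PowerSeries.mk fun n => iteratedDeriv n f 0 / (n.factorial : ℝ)

lemma coeff_taylorPowerSeries (f : ℝ → ℝ) (n : ℕ) :
    PowerSeries.coeff n (taylorPowerSeries f) = iteratedDeriv n f 0 / (n.factorial : ℝ) := by
  simp [taylorPowerSeries]

lemma taylorPowerSeries_mul {f g : ℝ → ℝ} (hf : AnalyticAt ℝ f 0) (hg : AnalyticAt ℝ g 0) :
    taylorPowerSeries (f * g) = taylorPowerSeries f * taylorPowerSeries g := by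
  ext n
  rw [PowerSeries.coeff_mul, coeff_taylorPowerSeries, iteratedDeriv_mul hf.contDiffAt hg.contDiffAt,
    Finset.Nat.sum_antidiagonal_eq_sum_range_succ_mk, Finset.sum_div]
  refine Finset.sum_congr rfl fun i hi => ?_
  have hi : i ≤ n := by simpa [Nat.lt_succ_iff] using hi
  rw [coeff_taylorPowerSeries, coeff_taylorPowerSeries, Nat.cast_choose ℝ hi]
  have := Nat.factorial_ne_zero n
  field_simp

lemma taylorPowerSeries_pow {f : ℝ → ℝ} (hf : AnalyticAt ℝ f 0) (k : ℕ) :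
    taylorPowerSeries (f ^ k) = taylorPowerSeries f ^ k := by
  induction k with
  | zero =>
    ext n
    rw [coeff_taylorPowerSeries, pow_zero, pow_zero, PowerSeries.coeff_one]
    change iteratedDeriv n (fun _ => (1 : ℝ)) 0 / _ = _
    rw [iteratedDeriv_const]
    split_ifs with h <;> simp [h]
  | succ k ih => rw [pow_succ, pow_succ, taylorPowerSeries_mul (hf.pow k) hf, ih]

lemma PowerSeries.coeff_pow_eq_sum_antidiagonalTuple {R : Type*} [CommSemiring R]
    (p : PowerSeries R) (k n : ℕ) :
    PowerSeries.coeff n (p ^ k) =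
      ∑ l ∈ Finset.Nat.antidiagonalTuple k n, ∏ i, PowerSeries.coeff (l i) p := by
  have h := PowerSeries.coeff_prod (fun _ : Fin k => p) n Finset.univ
  rw [Finset.prod_const, Finset.card_univ, Fintype.card_fin] at h
  rw [h]
  refine Finset.sum_equiv Finsupp.equivFunOnFinite (fun l => ?_) fun l _ => rfl
  simp [Finset.Nat.mem_antidiagonalTuple]

/-- Taylor coefficients of `exp ∘ f` at `0`, when `f` vanishes at `0`. -/
lemma coeff_taylorPowerSeries_exp_comp {f : ℝ → ℝ} (hf : AnalyticAt ℝ f 0) (hf0 : f 0 = 0)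
    (n : ℕ) :
    PowerSeries.coeff n (taylorPowerSeries fun t => Real.exp (f t)) =
      ∑ k ∈ Finset.range (n + 1),
        PowerSeries.coeff n (taylorPowerSeries f ^ k) / (k.factorial : ℝ) := by
  obtain ⟨F, hF, hFe⟩ := (analyticAt_rexp (x := 0)).exists_eq_sum_add_pow_mul (n + 1)
  have hcomp : AnalyticAt ℝ (F ∘ f) 0 := AnalyticAt.comp (by rwa [hf0]) hf
  have hX : PowerSeries.X ∣ taylorPowerSeries f := by
    rw [PowerSeries.X_dvd_iff, ← PowerSeries.coeff_zero_eq_constantCoeff_apply,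
      coeff_taylorPowerSeries]
    simp [hf0]
  have hrem : PowerSeries.coeff n (taylorPowerSeries (f ^ (n + 1) * (F ∘ f))) = 0 := by
    rw [taylorPowerSeries_mul (hf.pow _) hcomp, taylorPowerSeries_pow hf]
    exact PowerSeries.X_pow_dvd_iff.mp ((pow_dvd_pow_of_dvd hX _).mul_right _) n n.lt_succ_self
  have hexp : (fun t => Real.exp (f t)) =
      (fun t => ∑ k ∈ Finset.range (n + 1), (f ^ k) t / (k.factorial : ℝ)) +
        f ^ (n + 1) * (F ∘ f) := by
    ext t
    simp [hFe (f t), iteratedDeriv_eq_iterate]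
  rw [coeff_taylorPowerSeries] at hrem ⊢
  rw [hexp, iteratedDeriv_add
    (AnalyticAt.contDiffAt (Finset.analyticAt_fun_sum _ fun k _ => (hf.pow k).div_const))
    ((hf.pow _).mul hcomp).contDiffAt, add_div, hrem, add_zero,
    iteratedDeriv_fun_sum fun k _ => ((hf.pow k).div_const).contDiffAt, Finset.sum_div]
  refine Finset.sum_congr rfl fun k _ => ?_
  rw [← taylorPowerSeries_pow hf, coeff_taylorPowerSeries, iteratedDeriv_div_const, div_right_comm]

/-- The recursion for the Taylor coefficients of a solution of `K τ = τ - μ + μ * exp (K τ)`. -/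
lemma coeff_taylorPowerSeries_of_functional_equation {K : ℝ → ℝ} {μ : ℝ} (hK : AnalyticAt ℝ K 0)
    (hK0 : K 0 = 0) (hKeq : ∀ᶠ τ in nhds 0, K τ = τ - μ + μ * Real.exp (K τ)) {n : ℕ}
    (hn : n ≠ 0) :
    (1 - μ) * PowerSeries.coeff n (taylorPowerSeries K) = (if n = 1 then 1 else 0) +
      μ * ∑ k ∈ Finset.Icc 2 n,
        PowerSeries.coeff n (taylorPowerSeries K ^ k) / (k.factorial : ℝ) := by
  have hlin : iteratedDeriv n (fun τ : ℝ => τ - μ) 0 / (n.factorial : ℝ) =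
      if n = 1 then 1 else 0 := by
    obtain ⟨m, rfl⟩ := Nat.exists_eq_succ_of_ne_zero hn
    have hd : deriv (fun τ : ℝ => τ - μ) = fun _ => 1 := by ext; simp
    rw [iteratedDeriv_succ', hd, iteratedDeriv_const]
    by_cases hm : m = 0 <;> simp [hm]
  have hlin_an : AnalyticAt ℝ (fun τ : ℝ => τ - μ) 0 := by fun_prop
  have hexp_an : AnalyticAt ℝ (fun τ : ℝ => μ * Real.exp (K τ)) 0 :=
    analyticAt_const.fun_mul hK.rexp
  have h : PowerSeries.coeff n (taylorPowerSeries K) = (if n = 1 then 1 else 0) +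
      μ * PowerSeries.coeff n (taylorPowerSeries fun t => Real.exp (K t)) := by
    rw [coeff_taylorPowerSeries, Filter.EventuallyEq.iteratedDeriv_eq n hKeq,
      iteratedDeriv_fun_add hlin_an.contDiffAt hexp_an.contDiffAt,
      iteratedDeriv_const_mul_field, add_div, hlin, mul_div_assoc, coeff_taylorPowerSeries]
  have hsplit : ∑ k ∈ Finset.range (n + 1),
      PowerSeries.coeff n (taylorPowerSeries K ^ k) / (k.factorial : ℝ) =
      PowerSeries.coeff n (taylorPowerSeries K) + ∑ k ∈ Finset.Icc 2 n,
        PowerSeries.coeff n (taylorPowerSeries K ^ k) / (k.factorial : ℝ) := by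
    rw [Finset.range_eq_Ico, Finset.sum_eq_sum_Ico_succ_bot (by omega),
      Finset.sum_eq_sum_Ico_succ_bot (by omega)]
    simp [PowerSeries.coeff_one, hn, Finset.Ico_add_one_right_eq_Icc]
  rw [coeff_taylorPowerSeries_exp_comp hK hK0, hsplit] at h
  linear_combination h

/-- The power series `∑ (k+1)^k / (k+1)! z^k`, which sums to `T z / z` for the tree function `T`. -/
noncomputable def treeSeries : FormalMultilinearSeries ℝ ℝ ℝ :=
  FormalMultilinearSeries.ofScalars ℝ fun k : ℕ => ((k : ℝ) + 1) ^ k / ((k + 1).factorial : ℝ)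

lemma treeSeries_sum (z : ℝ) :
    treeSeries.sum z = ∑' k : ℕ, ((k : ℝ) + 1) ^ k / ((k + 1).factorial : ℝ) * z ^ k := by
  simp [treeSeries, FormalMultilinearSeries.sum, mul_comm]

lemma le_radius_treeSeries : ENNReal.ofReal (Real.exp (-1)) ≤ treeSeries.radius := by
  refine treeSeries.le_radius_of_bound (Real.exp 1) fun k => ?_
  have h1 : ((k : ℝ) + 1) ^ k ≤ ((k : ℝ) + 1) ^ (k + 1) :=
    pow_le_pow_right₀ (by linarith [(Nat.cast_nonneg k : (0 : ℝ) ≤ k)]) k.le_succ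
  have h2 := Real.pow_div_factorial_le_exp (x := (k : ℝ) + 1) (by positivity) (k + 1)
  rw [treeSeries, FormalMultilinearSeries.ofScalars_norm, Real.norm_of_nonneg (by positivity),
    Real.coe_toNNReal _ (Real.exp_pos _).le, ← Real.exp_nat_mul]
  calc ((k : ℝ) + 1) ^ k / ((k + 1).factorial : ℝ) * Real.exp (k * -1)
      ≤ Real.exp (k + 1) * Real.exp (k * -1) := by
        gcongr
        exact le_trans (by gcongr) h2
    _ = Real.exp 1 := by rw [← Real.exp_add]; ring_nf

lemma hasFPowerSeriesOnBall_treeSeries :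
    HasFPowerSeriesOnBall treeSeries.sum treeSeries 0 (ENNReal.ofReal (Real.exp (-1))) :=
  (treeSeries.hasFPowerSeriesOnBall
    ((ENNReal.ofReal_pos.mpr (Real.exp_pos _)).trans_le le_radius_treeSeries)).mono
    (ENNReal.ofReal_pos.mpr (Real.exp_pos _)) le_radius_treeSeries

lemma mem_eball_exp_neg_one {z : ℝ} (hz : |z| < Real.exp (-1)) :
    z ∈ Metric.eball (0 : ℝ) (ENNReal.ofReal (Real.exp (-1))) := by
  rw [Metric.eball_ofReal]; simpa using hz

lemma analyticAt_treeSeries_sum {z : ℝ} (hz : |z| < Real.exp (-1)) :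
    AnalyticAt ℝ treeSeries.sum z :=
  hasFPowerSeriesOnBall_treeSeries.analyticOnNhd z (mem_eball_exp_neg_one hz)

lemma summable_treeSeries {z : ℝ} (hz : |z| < Real.exp (-1)) :
    Summable fun k : ℕ => ((k : ℝ) + 1) ^ k / ((k + 1).factorial : ℝ) * z ^ k := by
  have := (hasFPowerSeriesOnBall_treeSeries.hasSum (mem_eball_exp_neg_one hz)).summable
  simpa [treeSeries, mul_comm] using this

/-- The alternating sum arising when `treeSeries` is composed with `w * exp (-w)`. -/
lemma sum_antidiagonal_treeSeries_coeff (m : ℕ) :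
    ∑ p ∈ antidiagonal m, ((p.1 : ℝ) + 1) ^ p.1 / ((p.1 + 1).factorial : ℝ) *
      ((-((p.1 : ℝ) + 1)) ^ p.2 / (p.2.factorial : ℝ)) = if m = 0 then 1 else 0 := by
  have h := congrFun (fwdDiff_iter_pow_eq_zero_of_lt (R := ℝ) m.lt_succ_self) 0
  rw [fwdDiff_iter_eq_sum_shift, sum_range_succ'] at h
  have hterm : ∀ p ∈ antidiagonal m, ((p.1 : ℝ) + 1) ^ p.1 / ((p.1 + 1).factorial : ℝ) *
      ((-((p.1 : ℝ) + 1)) ^ p.2 / (p.2.factorial : ℝ)) =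
      (((-1 : ℤ) ^ (m + 1 - (p.1 + 1)) * (m + 1).choose (p.1 + 1)) •
        ((0 : ℝ) + (p.1 + 1) • 1) ^ m) / ((m + 1).factorial : ℝ) := by
    rintro ⟨i, j⟩ hij
    obtain rfl := mem_antidiagonal.mp hij
    have hc : (((i + j + 1).choose (i + 1) : ℕ) : ℝ) =
        ((i + j + 1).factorial : ℝ) / (((i + 1).factorial : ℝ) * (j.factorial : ℝ)) := by
      rw [Nat.cast_choose ℝ (by omega)]
      congr 4
      omega
    have hs : i + j + 1 - (i + 1) = j := by omega
    have := Nat.factorial_ne_zero (i + j + 1)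
    simp only [hs, zsmul_eq_mul]
    push_cast
    rw [hc, neg_pow]
    simp only [nsmul_eq_mul]
    push_cast
    field_simp
    ring
  rw [sum_congr rfl hterm, Finset.Nat.sum_antidiagonal_eq_sum_range_succ_mk, ← sum_div]
  simp only [Nat.succ_eq_add_one] at h ⊢
  rw [eq_neg_of_add_eq_zero_left h]
  rcases eq_or_ne m 0 with rfl | hm
  · simp
  · simp [hm]

lemma treeSeries_sum_of_small {w : ℝ} (hw : |w| * Real.exp |w| < Real.exp (-1)) :
    treeSeries.sum (w * Real.exp (-w)) = Real.exp w := by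
  set c : ℕ → ℝ := fun k => ((k : ℝ) + 1) ^ k / ((k + 1).factorial : ℝ) with hc
  have hc0 : ∀ k, 0 ≤ c k := fun k => by positivity
  have hexp (x : ℝ) : HasSum (fun j : ℕ => x ^ j / (j.factorial : ℝ)) (Real.exp x) := by
    rw [Real.exp_eq_exp_ℝ]; exact NormedSpace.expSeries_div_hasSum_exp x
  let f : ℕ × ℕ → ℝ := fun p =>
    c p.1 * w ^ p.1 * ((-((p.1 : ℝ) + 1) * w) ^ p.2 / (p.2.factorial : ℝ))
  have hrow (k : ℕ) : HasSum (fun j => f (k, j)) (c k * w ^ k * Real.exp (-((k : ℝ) + 1) * w)) :=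
    (hexp _).mul_left _
  have hf : Summable f := by
    rw [← summable_norm_iff, summable_prod_of_nonneg fun _ => norm_nonneg _]
    have hnorm (k : ℕ) : HasSum (fun j => ‖f (k, j)‖)
        (c k * |w| ^ k * Real.exp (((k : ℝ) + 1) * |w|)) := by
      refine (funext fun j => ?_ : (fun j => ‖f (k, j)‖) = _) ▸
        (hexp (((k : ℝ) + 1) * |w|)).mul_left (c k * |w| ^ k)
      have hk : |(k : ℝ) + 1| = k + 1 := abs_of_nonneg (by positivity)
      simp only [f, norm_mul, norm_div, norm_pow, norm_neg, Real.norm_eq_abs, hk,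
        abs_of_nonneg (hc0 k), Nat.abs_cast]
    refine ⟨fun k => (hnorm k).summable, ?_⟩
    simp_rw [fun k => (hnorm k).tsum_eq]
    have hz : |(|w| * Real.exp |w|)| < Real.exp (-1) := by rwa [abs_of_nonneg (by positivity)]
    refine ((summable_treeSeries hz).mul_right (Real.exp |w|)).congr fun k => ?_
    rw [mul_pow, ← Real.exp_nat_mul, add_mul, one_mul, Real.exp_add]
    ring
  have h1 : ∑' p, f p = treeSeries.sum (w * Real.exp (-w)) * Real.exp (-w) := by
    rw [hf.tsum_prod, treeSeries_sum, ← tsum_mul_right]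
    refine tsum_congr fun k => ?_
    rw [(hrow k).tsum_eq, mul_pow, ← Real.exp_nat_mul,
      show -((k : ℝ) + 1) * w = k * -w + -w by ring, Real.exp_add]
    ring
  have h2 : ∑' p, f p = 1 := by
    have hf' : Summable fun p => f (Finset.HasAntidiagonal.sigmaAntidiagonalEquivProd p) :=
      Finset.HasAntidiagonal.sigmaAntidiagonalEquivProd.summable_iff.mpr hf
    rw [← Finset.HasAntidiagonal.sigmaAntidiagonalEquivProd.tsum_eq f,
      hf'.tsum_sigma' fun n => (hasSum_fintype _).summable]
    have hdiag (m : ℕ) : ∑' b : antidiagonal m,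
        f (Finset.HasAntidiagonal.sigmaAntidiagonalEquivProd ⟨m, b⟩) = if m = 0 then 1 else 0 := by
      rw [tsum_fintype]
      change ∑ b : antidiagonal m, f b = _
      rw [Finset.sum_coe_sort (antidiagonal m) f]
      trans w ^ m * if m = 0 then 1 else 0
      · rw [← sum_antidiagonal_treeSeries_coeff, mul_sum]
        refine sum_congr rfl fun p hp => ?_
        rw [← mem_antidiagonal.mp hp]
        simp only [f, hc]
        rw [mul_pow, pow_add]
        ring
      · split_ifs with h <;> simp [h]
    rw [tsum_congr hdiag, tsum_ite_eq]
  rw [h1] at h2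
  rw [eq_inv_of_mul_eq_one_left h2, Real.exp_neg, inv_inv]

lemma abs_mul_exp_neg_lt {w : ℝ} (hw : w ∈ Set.Ioo (-(1 / 8) : ℝ) 1) :
    |w * Real.exp (-w)| < Real.exp (-1) := by
  rw [abs_mul, Real.abs_exp]
  suffices |w| < Real.exp (w - 1) by
    calc |w| * Real.exp (-w) < Real.exp (w - 1) * Real.exp (-w) := by gcongr
      _ = Real.exp (-1) := by rw [← Real.exp_add]; ring_nf
  rcases le_total 0 w with h | h
  · rw [abs_of_nonneg h]
    linarith [Real.add_one_lt_exp (sub_ne_zero.mpr hw.2.ne)]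
  · rw [abs_of_nonpos h]
    have h1 : Real.exp (-2) ≤ Real.exp (w - 1) := Real.exp_le_exp.mpr (by linarith [hw.1])
    have h2 : Real.exp 2 < 8 := by
      rw [show (2 : ℝ) = 1 + 1 by norm_num, Real.exp_add]
      nlinarith [Real.exp_one_lt_d9, Real.exp_pos 1]
    have h3 : (1 / 8 : ℝ) < Real.exp (-2) := by
      rw [Real.exp_neg, one_div]
      exact inv_strictAnti₀ (Real.exp_pos _) h2
    linarith [hw.1]

/-- `w ↦ w * exp (-w)` is inverted by the tree function on `(-1/8, 1)`. -/
lemma treeSeries_sum_mul_exp_neg {w : ℝ} (hw : w ∈ Set.Ioo (-(1 / 8) : ℝ) 1) :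
    treeSeries.sum (w * Real.exp (-w)) = Real.exp w := by
  have hf : AnalyticOnNhd ℝ (fun w => treeSeries.sum (w * Real.exp (-w)))
      (Set.Ioo (-(1 / 8) : ℝ) 1) := fun x hx =>
    AnalyticAt.fun_comp (analyticAt_treeSeries_sum (abs_mul_exp_neg_lt hx)) (by fun_prop)
  have hg : AnalyticOnNhd ℝ Real.exp (Set.Ioo (-(1 / 8) : ℝ) 1) := fun x _ => analyticAt_rexp
  refine hf.eqOn_of_preconnected_of_eventuallyEq hg isPreconnected_Ioo (z₀ := 0) (by norm_num) ?_ hw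
  have hcont : Continuous fun w : ℝ => |w| * Real.exp |w| := by fun_prop
  have hlt : ∀ᶠ w : ℝ in nhds 0, |w| * Real.exp |w| < Real.exp (-1) :=
    hcont.continuousAt.eventually_lt continuousAt_const (by simp [Real.exp_pos])
  filter_upwards [hlt] with x hx using treeSeries_sum_of_small hx

lemma exists_mul_exp_neg_eq {z : ℝ} (hz : z ∈ Set.Ioo 0 (Real.exp (-1))) :
    ∃ w ∈ Set.Ioo (0 : ℝ) 1, w * Real.exp (-w) = z := by
  have hcont : ContinuousOn (fun w : ℝ => w * Real.exp (-w)) (Set.Icc 0 1) := by fun_prop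
  have := intermediate_value_Ioo zero_le_one hcont (by simpa using hz)
  simpa using this

/-- The functional equation of the cumulant generating function of the Borel distribution. -/
lemma borel_cgf_functional_equation {μ : ℝ} (hμ0 : 0 < μ) (hμ1 : μ < 1) :
    ∃ K : ℝ → ℝ, AnalyticAt ℝ K 0 ∧ K 0 = 0 ∧
      (K = fun τ : ℝ => Real.log
        (∑' k : ℕ, Real.exp (τ * (k + 1)) *
          (Real.exp (-μ * (k + 1)) * (μ * (k + 1)) ^ k / (k + 1).factorial))) ∧
      ∀ᶠ τ in nhds 0, K τ = τ - μ + μ * Real.exp (K τ) := by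
  have hsum (τ : ℝ) : (∑' k : ℕ, Real.exp (τ * (k + 1)) *
      (Real.exp (-μ * (k + 1)) * (μ * (k + 1)) ^ k / (k + 1).factorial)) =
      Real.exp (τ - μ) * treeSeries.sum (μ * Real.exp (τ - μ)) := by
    rw [treeSeries_sum, ← tsum_mul_left]
    refine tsum_congr fun k => ?_
    rw [show τ * ((k : ℝ) + 1) = k * τ + τ by ring, show -μ * ((k : ℝ) + 1) = k * -μ + -μ by ring,
      sub_eq_add_neg, Real.exp_add, Real.exp_add, Real.exp_add, mul_pow, mul_pow, mul_pow,
      Real.exp_nat_mul, Real.exp_nat_mul]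
    ring
  have hμ : μ ∈ Set.Ioo (-(1 / 8) : ℝ) 1 := ⟨by linarith, hμ1⟩
  have hlt : |μ * Real.exp (-μ)| < Real.exp (-1) := abs_mul_exp_neg_lt hμ
  have hval := treeSeries_sum_mul_exp_neg hμ
  refine ⟨_, ?_, ?_, rfl, ?_⟩
  · simp only [hsum]
    have hS : AnalyticAt ℝ (fun τ => treeSeries.sum (μ * Real.exp (τ - μ))) 0 :=
      AnalyticAt.fun_comp (by simpa using analyticAt_treeSeries_sum hlt) (by fun_prop)
    refine AnalyticAt.log (AnalyticAt.fun_mul (by fun_prop) hS) ?_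
    simp only [zero_sub, hval]
    positivity
  · simp only [hsum, zero_sub, hval, ← Real.exp_add]
    simp
  · have hnear : ∀ᶠ τ : ℝ in nhds 0, μ * Real.exp (τ - μ) < Real.exp (-1) := by
      refine ContinuousAt.eventually_lt (by fun_prop) continuousAt_const ?_
      simpa using (le_abs_self _).trans_lt hlt
    filter_upwards [hnear] with τ hτ
    obtain ⟨w, hw, hwz⟩ := exists_mul_exp_neg_eq ⟨by positivity, hτ⟩
    rw [hsum, ← hwz, treeSeries_sum_mul_exp_neg ⟨by linarith [hw.1], hw.2⟩, ← Real.exp_add,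
      Real.log_exp, Real.exp_add, ← mul_assoc, ← hwz, mul_assoc, ← Real.exp_add]
    simp

end

/-- Bell-polynomial recursion for the cumulants of the Borel distribution with
parameter `μ ∈ (0,1)`: `κ_X^{(1)} = 1/(1-μ)` and for `n ≥ 2`,
`κ_X^{(n)} = (μ/(1-μ)) Σ_{k=2}^n (n!/k!) Σ_{l₁+⋯+l_k=n, lᵢ≥1} κ^{(l₁)}⋯κ^{(l_k)}/(l₁!⋯l_k!)`. -/
theorem borel_cumulant_recursion (μ : ℝ) (hμ0 : 0 < μ) (hμ1 : μ < 1)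
    (κ : ℕ → ℝ)
    (hκ : ∀ n : ℕ, κ n =
      iteratedDeriv n (fun τ : ℝ => Real.log
        (∑' k : ℕ, Real.exp (τ * (k + 1)) *
          (Real.exp (-μ * (k + 1)) * (μ * (k + 1)) ^ k / (k + 1).factorial))) 0) :
    κ 1 = 1 / (1 - μ) ∧
    ∀ n : ℕ, 2 ≤ n →
      κ n = μ / (1 - μ) *
        ∑ k ∈ Finset.Icc 2 n,
          (n.factorial : ℝ) / (k.factorial : ℝ) *
            ∑ l ∈ (Finset.Nat.antidiagonalTuple k n).filter (fun l => ∀ i, 0 < l i),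
              ∏ i, κ (l i) / ((l i).factorial : ℝ) := by
  obtain ⟨K, hK, hK0, hKdef, hKeq⟩ := borel_cgf_functional_equation hμ0 hμ1
  rw [← hKdef] at hκ
  set P := taylorPowerSeries K with hP
  have hcoeff (n : ℕ) : PowerSeries.coeff n P = κ n / (n.factorial : ℝ) := by
    rw [hκ, hP, coeff_taylorPowerSeries]
  have hrec {n : ℕ} (hn : n ≠ 0) := coeff_taylorPowerSeries_of_functional_equation hK hK0 hKeq hn
  have hμ : 1 - μ ≠ 0 := (sub_pos.mpr hμ1).ne'
  refine ⟨?_, fun n hn => ?_⟩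
  · have h := hrec one_ne_zero
    rw [← hP, hcoeff] at h
    simp only [Finset.Icc_eq_empty_of_lt one_lt_two, Finset.sum_empty] at h
    rw [eq_div_iff hμ]
    simpa [mul_comm] using h
  · have h := hrec (n := n) (by omega)
    rw [← hP, hcoeff, if_neg (by omega), zero_add] at h
    have hn0 : (n.factorial : ℝ) ≠ 0 := by positivity
    have hsum : ∑ k ∈ Finset.Icc 2 n, (n.factorial : ℝ) / (k.factorial : ℝ) *
        ∑ l ∈ (Finset.Nat.antidiagonalTuple k n).filter (fun l => ∀ i, 0 < l i),
          ∏ i, κ (l i) / ((l i).factorial : ℝ) =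
        n.factorial * ∑ k ∈ Finset.Icc 2 n, PowerSeries.coeff n (P ^ k) / (k.factorial : ℝ) := by
      rw [Finset.mul_sum]
      refine Finset.sum_congr rfl fun k _ => ?_
      rw [PowerSeries.coeff_pow_eq_sum_antidiagonalTuple]
      simp only [hcoeff]
      rw [Finset.sum_filter_of_ne]
      · ring
      · intro l _ hl i
        refine Nat.pos_of_ne_zero fun hi => hl (Finset.prod_eq_zero (Finset.mem_univ i) ?_)
        simp [hi, hκ, hK0]
    rw [hsum]
    field_simp at h ⊢
    linarith
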